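/- Let σ : ℕ → [0,∞) satisfy ∑_{n∈ℕ} σ_n² < ∞, let I ⊆ ℕ, let γ = ⨂_{n∈ℕ} N(0,σ_n²), and let γ_I = ⨂_{n∈ℕ} N(0, 𝟙_I(n)·σ_n²) be countable product probability measures on ℝ^ℕ. Then ∫_{ℝ^ℕ} exp(−∑_{n∈ℕ} x_n²) dγ_I(x) − ∫_{ℝ^ℕ} exp(−∑_{n∈ℕ} x_n²) dγ(x) ≥ ( ∑_{n∈ℕ∖I} σ_n² ) · exp(−6 ∑_{n∈ℕ} σ_n² ). -/

import Mathlib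

open MeasureTheory ProbabilityTheory
open scoped NNReal

lemma integral_exp_neg_sq_gaussianReal (v : ℝ≥0) :
    ∫ x, Real.exp (-x ^ 2) ∂(gaussianReal 0 v) = (√(1 + 2 * (v : ℝ)))⁻¹ := by
  rcases eq_or_ne v 0 with rfl | hv
  · simp
  have hv' : (0 : ℝ) < v := by exact_mod_cast pos_iff_ne_zero.mpr hv
  rw [integral_gaussianReal_eq_integral_smul hv]
  have h : ∀ x : ℝ, gaussianPDFReal 0 v x • Real.exp (-x ^ 2) =
      (√(2 * Real.pi * v))⁻¹ * Real.exp (-(1 / (2 * v) + 1) * x ^ 2) := by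
    intro x
    rw [gaussianPDFReal, smul_eq_mul, mul_assoc, ← Real.exp_add]
    congr 2
    field_simp
    ring
  simp_rw [h]
  rw [integral_const_mul, integral_gaussian, ← Real.sqrt_inv, ← Real.sqrt_inv,
    ← Real.sqrt_mul (by positivity)]
  congr 1
  field_simp

lemma lintegral_sq_gaussianReal (v : ℝ≥0) :
    ∫⁻ x, ENNReal.ofReal (x ^ 2) ∂(gaussianReal 0 v) = ENNReal.ofReal v := by
  have hi : Integrable (fun x : ℝ => x ^ 2) (gaussianReal 0 v) :=
    (memLp_id_gaussianReal' 2 (by simp)).integrable_sq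
  rw [← ofReal_integral_eq_lintegral_ofReal hi (ae_of_all _ fun x => sq_nonneg x)]
  have h := variance_fun_id_gaussianReal (μ := 0) (v := v)
  rw [variance_of_integral_eq_zero (by fun_prop) (by simp)] at h
  rw [h]

lemma integral_exp_neg_sum_sq_infinitePi_gaussianReal (v : ℕ → ℝ≥0) (J : Finset ℕ) :
    ∫ x, Real.exp (-∑ n ∈ J, (x n) ^ 2) ∂(Measure.infinitePi fun n => gaussianReal 0 (v n)) =
      ∏ n ∈ J, (√(1 + 2 * (v n : ℝ)))⁻¹ := by
  have h : ∀ x : ℕ → ℝ, Real.exp (-∑ n ∈ J, (x n) ^ 2) =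
      (fun y : J → ℝ => ∏ j, Real.exp (-(y j) ^ 2)) (J.restrict x) := by
    intro x
    rw [← Finset.sum_neg_distrib, Real.exp_sum, ← Finset.prod_coe_sort]
    rfl
  simp_rw [h]
  rw [integral_restrict_infinitePi (μ := fun n => gaussianReal 0 (v n))
    (f := fun y : J → ℝ => ∏ j, Real.exp (-(y j) ^ 2))
    (Continuous.aestronglyMeasurable (by fun_prop)),
    integral_fintype_prod_eq_prod (f := fun (_ : J) (t : ℝ) => Real.exp (-t ^ 2))]
  simp_rw [integral_exp_neg_sq_gaussianReal]
  exact Finset.prod_coe_sort J fun n => (√(1 + 2 * (v n : ℝ)))⁻¹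

lemma ae_summable_sq_infinitePi_gaussianReal {v : ℕ → ℝ≥0} (hv : Summable fun n => (v n : ℝ)) :
    ∀ᵐ x ∂(Measure.infinitePi fun n => gaussianReal 0 (v n)), Summable fun n => (x n) ^ 2 := by
  have hfin : ∫⁻ x, ∑' n, ENNReal.ofReal ((x n) ^ 2)
      ∂(Measure.infinitePi fun n => gaussianReal 0 (v n)) ≠ ⊤ := by
    rw [lintegral_tsum (fun n => Measurable.aemeasurable (by fun_prop))]
    have h : ∀ n, ∫⁻ x, ENNReal.ofReal ((x n) ^ 2)
        ∂(Measure.infinitePi fun n => gaussianReal 0 (v n)) = ENNReal.ofReal (v n) := by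
      intro n
      rw [← lintegral_sq_gaussianReal, ← Measure.infinitePi_map_eval
        (fun n => gaussianReal 0 (v n)) n, lintegral_map (by fun_prop) (by fun_prop)]
    simp_rw [h]
    exact hv.tsum_ofReal_ne_top
  filter_upwards [ae_lt_top (by fun_prop) hfin] with x hx
  simpa [ENNReal.toReal_ofReal, sq_nonneg] using ENNReal.summable_toReal hx.ne

lemma tendsto_prod_integral_exp_neg_tsum_sq {v : ℕ → ℝ≥0} (hv : Summable fun n => (v n : ℝ))
    {μ : Measure (ℕ → ℝ)} (hμ : IsProjectiveLimit μ fun J : Finset ℕ =>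
      Measure.pi fun j : J => gaussianReal 0 (v j)) :
    Filter.Tendsto (fun N => ∏ n ∈ Finset.range N, (√(1 + 2 * (v n : ℝ)))⁻¹) Filter.atTop
      (nhds (∫ x, Real.exp (-∑' n, (x n) ^ 2) ∂μ)) := by
  obtain rfl := hμ.unique (Measure.isProjectiveLimit_infinitePi fun n => gaussianReal 0 (v n))
  simp_rw [← integral_exp_neg_sum_sq_infinitePi_gaussianReal]
  refine tendsto_integral_of_dominated_convergence (fun _ => 1)
    (fun N => Continuous.aestronglyMeasurable (by fun_prop))
    (integrable_const 1) (fun N => ae_of_all _ fun x => ?_) ?_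
  · rw [Real.norm_eq_abs, Real.abs_exp, Real.exp_le_one_iff, neg_nonpos]
    exact Finset.sum_nonneg fun n _ => sq_nonneg _
  · filter_upwards [ae_summable_sq_infinitePi_gaussianReal hv] with x hx
    exact (Real.continuous_exp.tendsto _).comp hx.hasSum.tendsto_sum_nat.neg

lemma exp_neg_sum_le_prod_inv_sqrt {ι : Type*} (J : Finset ι) {u : ι → ℝ} (hu : ∀ i, 0 ≤ u i) :
    Real.exp (-∑ i ∈ J, u i) ≤ ∏ i ∈ J, (√(1 + 2 * u i))⁻¹ := by
  rw [← Finset.sum_neg_distrib, Real.exp_sum]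
  refine Finset.prod_le_prod (fun i _ => (Real.exp_pos _).le) fun i _ => ?_
  have := hu i
  rw [Real.exp_neg]
  gcongr
  rw [Real.sqrt_le_left (Real.exp_pos _).le, ← Real.exp_nat_mul]
  have := Real.add_one_le_exp (2 * u i)
  push_cast
  linarith

lemma prod_inv_sqrt_le {ι : Type*} (J : Finset ι) {w : ι → ℝ} (hw : ∀ i, 0 ≤ w i) :
    ∏ i ∈ J, (√(1 + 2 * w i))⁻¹ ≤ (√(1 + 2 * ∑ i ∈ J, w i))⁻¹ := by
  classical
  induction J using Finset.induction_on with
  | empty => simp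
  | insert a s ha ih =>
    have h1 := hw a
    have h2 : 0 ≤ ∑ i ∈ s, w i := Finset.sum_nonneg fun i _ => hw i
    rw [Finset.prod_insert ha, Finset.sum_insert ha]
    calc _ ≤ (√(1 + 2 * w a))⁻¹ * (√(1 + 2 * ∑ i ∈ s, w i))⁻¹ := by gcongr
      _ = (√((1 + 2 * w a) * (1 + 2 * ∑ i ∈ s, w i)))⁻¹ := by
        rw [Real.sqrt_mul (by positivity), mul_inv]
      _ ≤ _ := by
        gcongr
        nlinarith [mul_nonneg h1 h2]

lemma mul_exp_le_one_sub_inv_sqrt {t : ℝ} (ht : 0 ≤ t) :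
    t * Real.exp (-5 * t) ≤ 1 - (√(1 + 2 * t))⁻¹ := by
  set a := √(1 + 2 * t) with ha
  have hsq : a ^ 2 = 1 + 2 * t := Real.sq_sqrt (by positivity)
  have ha1 : 1 ≤ a := Real.one_le_sqrt.mpr (by linarith)
  have hE : Real.exp (-5 * t) ≤ 2 / (a * (a + 1)) := by
    rw [neg_mul, Real.exp_neg, inv_le_comm₀ (Real.exp_pos _) (by positivity), inv_div]
    nlinarith [Real.add_one_le_exp (5 * t), sq_nonneg (a - 1)]
  calc t * Real.exp (-5 * t) ≤ t * (2 / (a * (a + 1))) := by gcongr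
    _ = 1 - a⁻¹ := by
      have ht' : t = (a ^ 2 - 1) / 2 := by linarith
      rw [ht']
      field_simp
      ring

lemma sum_mul_exp_le_prod_inv_sqrt_sub {ι : Type*} (J : Finset ι) {u w : ι → ℝ}
    (hu : ∀ i, 0 ≤ u i) (hw : ∀ i, 0 ≤ w i) (huw : ∀ i, u i * w i = 0) :
    (∑ i ∈ J, w i) * Real.exp (-6 * ∑ i ∈ J, (u i + w i)) ≤
      (∏ i ∈ J, (√(1 + 2 * u i))⁻¹) - ∏ i ∈ J, (√(1 + 2 * (u i + w i)))⁻¹ := by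
  have hU : 0 ≤ ∑ i ∈ J, u i := Finset.sum_nonneg fun i _ => hu i
  have hW : 0 ≤ ∑ i ∈ J, w i := Finset.sum_nonneg fun i _ => hw i
  have hsplit : ∏ i ∈ J, (√(1 + 2 * (u i + w i)))⁻¹ =
      (∏ i ∈ J, (√(1 + 2 * u i))⁻¹) * ∏ i ∈ J, (√(1 + 2 * w i))⁻¹ := by
    rw [← Finset.prod_mul_distrib]
    refine Finset.prod_congr rfl fun i _ => ?_
    have := hu i
    rw [← mul_inv, ← Real.sqrt_mul (by positivity)]
    congr 2
    linear_combination (-4) * huw i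
  rw [hsplit, Finset.sum_add_distrib]
  calc _ ≤ (∑ i ∈ J, w i) * Real.exp (-∑ i ∈ J, u i + -5 * ∑ i ∈ J, w i) := by
        gcongr
        linarith
    _ = Real.exp (-∑ i ∈ J, u i) * ((∑ i ∈ J, w i) * Real.exp (-5 * ∑ i ∈ J, w i)) := by
        rw [Real.exp_add]
        ring
    _ ≤ (∏ i ∈ J, (√(1 + 2 * u i))⁻¹) * (1 - ∏ i ∈ J, (√(1 + 2 * w i))⁻¹) := by
        refine mul_le_mul (exp_neg_sum_le_prod_inv_sqrt J hu) ?_ (by positivity)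
          (Finset.prod_nonneg fun i _ => by positivity)
        linarith [mul_exp_le_one_sub_inv_sqrt hW, prod_inv_sqrt_le J hw]
    _ = _ := by ring

/-- Proposition 2.9 (Gaussian content): for `σ : ℕ → [0,∞)` with `∑_n σ_n² < ∞`, `I ⊆ ℕ`,
and the countable product probability measures `γ = ⨂_n N(0,σ_n²)` and
`γ_I = ⨂_n N(0, 𝟙_I(n) σ_n²)` on `ℝ^ℕ` (characterized as projective limits of the finite
product Gaussian measures), it holds that
`∫ exp(-∑_n x_n²) dγ_I - ∫ exp(-∑_n x_n²) dγ ≥ (∑_{n∉I} σ_n²) exp(-6 ∑_n σ_n²)`. -/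
theorem stmt_11 (σ : ℕ → ℝ≥0) (hσ : Summable fun n => ((σ n : ℝ)) ^ 2) (I : Set ℕ)
    (γ γI : Measure (ℕ → ℝ))
    (hγ : IsProjectiveLimit γ fun J : Finset ℕ =>
      Measure.pi fun j : J => gaussianReal 0 ((σ j) ^ 2))
    (hγI : IsProjectiveLimit γI fun J : Finset ℕ =>
      Measure.pi fun j : J => gaussianReal 0 (I.indicator (fun n => (σ n) ^ 2) j)) :
    (∫ x, Real.exp (-∑' n, (x n) ^ 2) ∂γI) - ∫ x, Real.exp (-∑' n, (x n) ^ 2) ∂γ ≥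
      (∑' n : {n : ℕ // n ∉ I}, ((σ n : ℝ)) ^ 2) *
        Real.exp (-6 * ∑' n, ((σ n : ℝ)) ^ 2) := by
  set s : ℕ → ℝ := fun n => (σ n : ℝ) ^ 2 with hs
  have hs0 : ∀ n, 0 ≤ s n := fun n => sq_nonneg _
  have hcoe : ∀ n, ((I.indicator (fun n => (σ n) ^ 2) n : ℝ≥0) : ℝ) = I.indicator s n := by
    intro n
    by_cases hn : n ∈ I <;> simp [hn, hs]
  have hadd : ∀ n, I.indicator s n + Iᶜ.indicator s n = s n := fun n =>
    congrFun (Set.indicator_self_add_compl I s) n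
  have hγlim := tendsto_prod_integral_exp_neg_tsum_sq (v := fun n => (σ n) ^ 2)
    (by simpa using hσ) hγ
  have hγIlim := tendsto_prod_integral_exp_neg_tsum_sq
    (v := I.indicator fun n => (σ n) ^ 2) (by simpa only [hcoe] using hσ.indicator I) hγI
  have hT : (∑' n : {n : ℕ // n ∉ I}, ((σ n : ℝ)) ^ 2) = ∑' n, Iᶜ.indicator s n :=
    tsum_subtype Iᶜ s
  rw [hT]
  refine le_of_tendsto_of_tendsto'
    ((hσ.indicator Iᶜ).hasSum.tendsto_sum_nat.mul
      ((Real.continuous_exp.tendsto _).comp (hσ.hasSum.tendsto_sum_nat.const_mul (-6))))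
    (hγIlim.sub hγlim) fun N => ?_
  have h := sum_mul_exp_le_prod_inv_sqrt_sub (Finset.range N)
    (u := I.indicator s) (w := Iᶜ.indicator s)
    (fun n => Set.indicator_nonneg (fun n _ => hs0 n) n)
    (fun n => Set.indicator_nonneg (fun n _ => hs0 n) n)
    (fun n => by by_cases hn : n ∈ I <;> simp [hn])
  simp only [hadd] at h
  simpa [hcoe, hs] using h
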